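/- Every irrational real number ξ whose irrationality exponent equals 2 satisfies liminf_{n→∞} p(n, ξ, b)/n ≥ 9/8 for every integer base b ≥ 2. -/

import Mathlib

open Filter

/-- The `k`-th digit (0-indexed; this is `a_{k+1}`) of the base-`b` expansion
of `ξ`, i.e. `a_j = ⌊b^j ξ⌋ mod b`. -/
noncomputable def digit (b : ℕ) (ξ : ℝ) (k : ℕ) : ℕ :=
  (⌊ξ * (b : ℝ) ^ (k + 1)⌋ % (b : ℤ)).toNat

/-- Number of distinct factors of length `n` of the infinite word `x`. -/
noncomputable def complexity {A : Type*} (x : ℕ → A) (n : ℕ) : ℕ :=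
  Set.ncard {w : Fin n → A | ∃ j : ℕ, ∀ k : Fin n, w k = x (j + k)}

/-- The set of lengths `m` of prefixes of `x` whose last `n` letters occur
a second time inside the prefix. -/
def returnSet {A : Type*} (x : ℕ → A) (n : ℕ) : Set ℕ :=
  {m : ℕ | ∃ i : ℕ, i + n < m ∧ ∀ k < n, x (i + k) = x (m - n + k)}

/-- `r(n, x)`: the length of the smallest prefix of `x` containing two
(possibly overlapping) occurrences of some word of length `n`. -/
noncomputable def minReturn {A : Type*} (x : ℕ → A) (n : ℕ) : ℕ :=
  sInf (returnSet x n)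

/-- The irrationality exponent of `ξ`, as an extended real: the supremum of
all real `μ` such that `|ξ - p/q| < q^(-μ)` has infinitely many rational
solutions `p/q` with `q ≥ 1`. -/
noncomputable def irrationalityExponent (ξ : ℝ) : EReal :=
  sSup {e : EReal | ∃ μ : ℝ, e = (μ : EReal) ∧
    {pq : ℤ × ℕ | 1 ≤ pq.2 ∧ |ξ - pq.1 / pq.2| < (pq.2 : ℝ) ^ (-μ)}.Infinite}



/-- The blocks of length `m` of the word `x` starting at positions `i` and `j` coincide. -/
def BlockEq {A : Type*} (x : ℕ → A) (i j m : ℕ) : Prop :=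
  ∀ k < m, x (i + k) = x (j + k)

/-- The word `x` has period `p` on the interval `[a, c)`. -/
def PeriodicOn {A : Type*} (x : ℕ → A) (p a c : ℕ) : Prop :=
  ∀ t, a ≤ t → t + p < c → x t = x (t + p)

section Words

variable {A : Type*} {x : ℕ → A}

lemma BlockEq.mono {i j m n : ℕ} (h : BlockEq x i j m) (hn : n ≤ m) : BlockEq x i j n :=
  fun k hk => h k (hk.trans_le hn)

lemma BlockEq.periodicOn {i j m : ℕ} (hij : i < j) (h : BlockEq x i j m) :
    PeriodicOn x (j - i) i (j + m) := by
  intro t ht htm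
  have := h (t - i) (by omega)
  rwa [show i + (t - i) = t by omega, show j + (t - i) = t + (j - i) by omega] at this

lemma PeriodicOn.mul {p a c : ℕ} (h : PeriodicOn x p a c) (k : ℕ) :
    PeriodicOn x (k * p) a c := by
  induction k with
  | zero => intro t _ _; simp
  | succ k ih =>
    intro t ht htc
    have e : (k + 1) * p = k * p + p := by ring
    rw [e] at htc ⊢
    rw [ih t ht (by omega), h (t + k * p) (by omega) (by omega), add_assoc]

/-- A period of a long enough subinterval that divides a period of the whole interval is a period
of the whole interval. -/
lemma PeriodicOn.extend {p g a c a' c' : ℕ} (hp : PeriodicOn x p a c) (hg : PeriodicOn x g a' c')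
    (hdvd : g ∣ p) (hp0 : 0 < p) (ha : a ≤ a') (hc : c' ≤ c) (hlen : a' + p ≤ c') :
    PeriodicOn x g a c := by
  obtain ⟨q, rfl⟩ := hdvd
  have hg0 : 0 < g := Nat.pos_of_mul_pos_right hp0
  have hq : g * q = (q - 1) * g + g := by
    rcases q with _ | q
    · omega
    · simp; ring
  have right : ∀ n, c' + n ≤ c → PeriodicOn x g a' (c' + n) := by
    intro n
    induction n with
    | zero => intro _; exact hg
    | succ n ih =>
      intro hn t ht htc
      have ih' := ih (by omega)
      by_cases h1 : t + g < c' + n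
      · exact ih' t ht h1
      · have e1 := hp (t + g - g * q) (by omega) (by omega)
        have e2 := ih'.mul (q - 1) (t + g - g * q) (by omega) (by omega)
        rw [show t + g - g * q + g * q = t + g by omega] at e1
        rw [show t + g - g * q + (q - 1) * g = t by omega] at e2
        rw [← e1, e2]
  have hr : PeriodicOn x g a' c := by
    have := right (c - c') (by omega)
    rwa [show c' + (c - c') = c by omega] at this
  have left : ∀ n, a + n ≤ a' → PeriodicOn x g (a' - n) c := by
    intro n
    induction n with
    | zero => intro _; exact hr
    | succ n ih =>
      intro hn t ht htc
      have ih' := ih (by omega)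
      by_cases h1 : a' - n ≤ t
      · exact ih' t h1 htc
      · have e1 := hp t (by omega) (by omega)
        have e2 := ih'.mul (q - 1) (t + g) (by omega) (by omega)
        rw [show t + g + (q - 1) * g = t + g * q by omega] at e2
        rw [e1, e2]
  have := left (a' - a) (by omega)
  rwa [show a' - (a' - a) = a by omega] at this

/-- The theorem of Fine and Wilf, in its weak form. -/
lemma PeriodicOn.gcd {p q a c : ℕ} (hp0 : 0 < p) (hq0 : 0 < q) (hp : PeriodicOn x p a c)
    (hq : PeriodicOn x q a c) (hlen : a + p + q ≤ c) : PeriodicOn x (p.gcd q) a c := by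
  obtain ⟨s, hs⟩ : ∃ s, p + q = s := ⟨_, rfl⟩
  induction s using Nat.strong_induction_on generalizing p q c with
  | _ s ih =>
    have key : ∀ p q : ℕ, 0 < p → p < q → p + q = s → PeriodicOn x p a c → PeriodicOn x q a c →
        a + p + q ≤ c → PeriodicOn x (p.gcd q) a c := by
      intro p q hp0 hpq hs hp hq hlen
      have h1 : PeriodicOn x p a (c - p) := fun t ht htc => hp t ht (by omega)
      have h2 : PeriodicOn x (q - p) a (c - p) := by
        intro t ht htc
        have e1 := hq t ht (by omega)
        have e2 := hp (t + (q - p)) (by omega) (by omega)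
        rw [e1, e2]
        congr 1; omega
      have h3 := ih q (by omega) hp0 (by omega) h1 h2 (by omega) (by omega)
      rw [Nat.gcd_sub_self_right hpq.le] at h3
      exact hp.extend h3 (Nat.gcd_dvd_left p q) hp0 le_rfl (by omega) (by omega)
    rcases lt_trichotomy p q with h | rfl | h
    · exact key p q hp0 h hs hp hq hlen
    · simpa using hp
    · rw [Nat.gcd_comm]
      exact key q p hq0 h (by omega) hq hp (by omega)

/-- A repetition `(i, j, m)`: the blocks of length `m` at positions `i < j` coincide, `m` is maximal
for `i` and `j`, and no block of length `n ≤ m` starting before `j` is repeated before `j`. -/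
structure FirstRepetition (x : ℕ → A) (n i j m : ℕ) : Prop where
  lt : i < j
  le : n ≤ m
  blockEq : BlockEq x i j m
  ne : x (i + m) ≠ x (j + m)
  first : ∀ i' j', i' < j' → BlockEq x i' j' n → j ≤ j'

lemma exists_firstRepetition {n J B : ℕ} (h : ∃ i j, i < j ∧ j ≤ J ∧ BlockEq x i j n)
    (hB : ∀ i j m, i < j → j ≤ J → n ≤ m → BlockEq x i j m → m ≤ B) :
    ∃ i j m, FirstRepetition x n i j m ∧ j ≤ J := by
  classical
  obtain ⟨i₀, j₀, h₀, hJ, hb₀⟩ := h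
  have hex : ∃ j, ∃ i, i < j ∧ BlockEq x i j n := ⟨j₀, i₀, h₀, hb₀⟩
  obtain ⟨i, hi, hb⟩ := Nat.find_spec hex
  set j := Nat.find hex with hj
  have hjJ : j ≤ J := (Nat.find_min' hex ⟨i₀, h₀, hb₀⟩).trans hJ
  have hnB := hB i j n hi hjJ le_rfl hb
  have hm : BlockEq x i j (Nat.findGreatest (fun m => BlockEq x i j m) B) :=
    Nat.findGreatest_spec (P := fun m => BlockEq x i j m) hnB hb
  have hnm : n ≤ Nat.findGreatest (fun m => BlockEq x i j m) B :=
    Nat.le_findGreatest (P := fun m => BlockEq x i j m) hnB hb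
  refine ⟨i, j, _, ⟨hi, hnm, hm, fun he => ?_, fun i' j' h' hb' => Nat.find_min' hex ⟨i', h', hb'⟩⟩,
    hjJ⟩
  set m := Nat.findGreatest (fun m => BlockEq x i j m) B
  have hm1 : BlockEq x i j (m + 1) := by
    intro k hk
    rcases Nat.lt_succ_iff_lt_or_eq.mp hk with h | rfl
    · exact hm k h
    · exact he
  have h1 := Nat.le_findGreatest (P := fun m => BlockEq x i j m)
    (hB i j (m + 1) hi hjJ (by omega) hm1) hm1
  exact absurd h1 (Nat.not_succ_le_self m)

lemma FirstRepetition.not_periodicOn {n i j m g : ℕ} (h : FirstRepetition x n i j m) (hg : 0 < g)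
    (hgij : g < j - i) : ¬ PeriodicOn x g i (j + m) := by
  intro hp
  have := h.first i (i + g) (by omega) fun k hk => by
    have := hp (i + k) (by omega) (by have := h.le; omega)
    rw [this]; congr 1; omega
  omega

/-- Of two consecutive first repetitions, one starts early in the word. -/
lemma FirstRepetition.add_min_lt {n i j m i' j' m' : ℕ} (h : FirstRepetition x n i j m)
    (h' : FirstRepetition x (m + 1) i' j' m') : m + min i i' < j' := by
  by_contra! hcon
  have hv := h.lt
  have hv' := h'.lt
  have hm' := h'.le
  have hjj' : j ≤ j' := h.first i' j' hv' (h'.blockEq.mono (by have := h.le; omega))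
  have hp := h.blockEq.periodicOn hv
  have hp' := h'.blockEq.periodicOn hv'
  have hg := PeriodicOn.gcd (a := max i i') (c := j + m) (p := j - i) (q := j' - i') (x := x)
    (by omega) (by omega) (fun t ht htc => hp t (by omega) htc)
    (fun t ht htc => hp' t (by omega) (by omega)) (by omega)
  have hg0 : 0 < (j - i).gcd (j' - i') := Nat.gcd_pos_of_pos_left _ (by omega)
  have h1 := hp.extend hg (Nat.gcd_dvd_left _ _) (by omega) (by omega) le_rfl (by omega)
  have h2 := hp'.extend hg (Nat.gcd_dvd_right _ _) (by omega) (by omega) (by omega) (by omega)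
  have e1 : (j - i).gcd (j' - i') = j - i :=
    le_antisymm (Nat.gcd_le_left _ (by omega))
      (not_lt.mp fun hlt => h.not_periodicOn hg0 hlt h1)
  have e2 : (j - i).gcd (j' - i') = j' - i' :=
    le_antisymm (Nat.gcd_le_right _ (by omega))
      (not_lt.mp fun hlt => h'.not_periodicOn hg0 hlt h2)
  apply h.ne
  have := hp' (i + m) (by omega) (by omega)
  rw [this]; congr 1; omega

/-- Two repetitions that both start early produce a repetition of a long block still earlier. -/
lemma exists_blockEq_of_blockEq {i j m i' j' m' : ℕ} (hij : i < j) (hij' : i' < j') (hjj' : j ≤ j')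
    (hmm' : m < m') (hi' : i' ≤ i + m) (hb : BlockEq x i j m) (hne : x (i + m) ≠ x (j + m))
    (hb' : BlockEq x i' j' m') :
    ∃ s t, s < t ∧ t ≤ max (j' - j + i) i' ∧ BlockEq x s t (m - (j' - j)) := by
  have hp := hb.periodicOn hij
  have hp' := hb'.periodicOn hij'
  rcases lt_trichotomy (j - i) (j' - i') with h | h | h
  · refine ⟨i', j' - j + i, by omega, le_max_left _ _, fun k hk => ?_⟩
    have e1 := hp' (i' + k) (by omega) (by omega)
    have e2 := hp (j' - j + i + k) (by omega) (by omega)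
    rw [e1, e2]; congr 1; omega
  · refine absurd ?_ hne
    have := hp' (i + m) (by omega) (by omega)
    rw [this]; congr 1; omega
  · refine ⟨j' - j + i, i', by omega, le_max_right _ _, fun k hk => ?_⟩
    have e1 := hp' (i' + k) (by omega) (by omega)
    have e2 := hp (j' - j + i + k) (by omega) (by omega)
    rw [e1, e2]; congr 1; omega

/-- A word in which repetitions of long blocks occur late cannot have all its short blocks repeated
early. -/
lemma not_forall_exists_blockEq {N d E M : ℕ} (hN : 8 * d + 8 * E + 7 + M < N)
    (hlate : ∀ i j m, i < j → j ≤ 2 * N → M ≤ m → BlockEq x i j m → m ≤ j + E) :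
    ¬ ∀ n ≤ N, ∃ i j, i < j ∧ j ≤ n + d ∧ BlockEq x i j n := by
  intro hearly
  have step : ∀ n, M ≤ n → n ≤ N → ∃ i j m, FirstRepetition x n i j m ∧ j ≤ n + d ∧ m ≤ j + E := by
    intro n hMn hnN
    obtain ⟨i, j, m, h, hj⟩ := exists_firstRepetition (B := n + d + E) (hearly n hnN)
      fun i j m hij hj hm hb => by
        have := hlate i j m hij (by omega) (by omega) hb
        omega
    exact ⟨i, j, m, h, hj, hlate i j m h.lt (by omega) (hMn.trans h.le) h.blockEq⟩
  have clash : ∀ n i j m n' i' j' m', FirstRepetition x n i j m → FirstRepetition x n' i' j' m' →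
      n ≤ n' → 5 * d + 5 * E + 4 + M < m → m < m' → i ≤ d → i' ≤ d → j' ≤ 2 * N → m ≤ j + E →
      j' ≤ m + 2 * d + E + 2 → False := by
    intro n i j m n' i' j' m' h h' hnn' hm hmm' hi hi' hj' hmj hjm
    have hjj' := h.first i' j' h'.lt (h'.blockEq.mono (hnn'.trans h'.le))
    obtain ⟨s, t, hst, ht, hb⟩ := exists_blockEq_of_blockEq h.lt h'.lt hjj' hmm' (by omega)
      h.blockEq h.ne h'.blockEq
    have := hlate s t _ hst (by omega) (by omega) hb
    omega
  obtain ⟨i₀, j₀, m₀, h₀, hj₀, hm₀⟩ := step (N - 3 * (d + E + 1)) (by omega) (by omega)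
  have l₀ := h₀.le
  obtain ⟨i₁, j₁, m₁, h₁, hj₁, hm₁⟩ := step (m₀ + 1) (by omega) (by omega)
  have l₁ := h₁.le
  obtain ⟨i₂, j₂, m₂, h₂, hj₂, hm₂⟩ := step (m₁ + 1) (by omega) (by omega)
  have l₂ := h₂.le
  obtain ⟨i₃, j₃, m₃, h₃, hj₃, hm₃⟩ := step (m₂ + 1) (by omega) (by omega)
  have l₃ := h₃.le
  have a₁ := h₀.add_min_lt h₁
  have a₂ := h₁.add_min_lt h₂
  have a₃ := h₂.add_min_lt h₃
  by_cases c₁ : i₁ ≤ d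
  · by_cases c₂ : i₂ ≤ d
    · exact clash _ _ _ _ _ _ _ _ h₁ h₂ (by omega) (by omega) (by omega) c₁ c₂ (by omega)
        (by omega) (by omega)
    · exact clash _ _ _ _ _ _ _ _ h₁ h₃ (by omega) (by omega) (by omega) c₁ (by omega) (by omega)
        (by omega) (by omega)
  · exact clash _ _ _ _ _ _ _ _ h₀ h₂ (by omega) (by omega) (by omega) (by omega) (by omega)
      (by omega) (by omega) (by omega)

end Words

lemma finite_setOf_blocks {b : ℕ} {x : ℕ → ℕ} (hx : ∀ k, x k < b) (n : ℕ) :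
    {w : Fin n → ℕ | ∃ j : ℕ, ∀ k : Fin n, w k = x (j + k)}.Finite := by
  refine (Set.Finite.pi fun _ : Fin n => Set.finite_Iio b).subset ?_
  rintro w ⟨j, hj⟩ k -
  rw [hj k]
  exact hx _

lemma complexity_lt_complexity_succ {b : ℕ} {x : ℕ → ℕ} (hx : ∀ k, x k < b)
    (hper : ∀ i j, i < j → ∃ m, ¬ BlockEq x i j m) (n : ℕ) :
    complexity x n < complexity x (n + 1) := by
  by_contra! hcon
  unfold complexity at hcon
  set F := {w : Fin (n + 1) → ℕ | ∃ j : ℕ, ∀ k : Fin (n + 1), w k = x (j + k)} with hF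
  set f : (Fin (n + 1) → ℕ) → (Fin n → ℕ) := fun w k => w k.castSucc with hf
  have hfin : F.Finite := finite_setOf_blocks hx (n + 1)
  have himg : {w : Fin n → ℕ | ∃ j : ℕ, ∀ k : Fin n, w k = x (j + k)} = f '' F := by
    ext w
    constructor
    · rintro ⟨j, hj⟩
      exact ⟨fun k => x (j + k), ⟨j, fun k => rfl⟩, funext fun k => by simp [hf, hj k]⟩
    · rintro ⟨w', ⟨j, hj⟩, rfl⟩
      exact ⟨j, fun k => by simp [hf, hj]⟩
  rw [himg] at hcon
  have hinj : Set.InjOn f F :=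
    (Set.ncard_image_iff hfin).mp (le_antisymm (Set.ncard_image_le hfin) hcon)
  have hext : ∀ i j, BlockEq x i j n → BlockEq x i j (n + 1) := by
    intro i j h k hk
    have := hinj (x₁ := fun k => x (i + k)) ⟨i, fun k => rfl⟩ (x₂ := fun k => x (j + k))
      ⟨j, fun k => rfl⟩ (funext fun k => h k k.2)
    exact congrFun this ⟨k, hk⟩
  obtain ⟨i, j, hij, he⟩ := Set.Finite.exists_lt_map_eq_of_forall_mem
    (t := {w : Fin n → ℕ | ∃ j : ℕ, ∀ k : Fin n, w k = x (j + k)})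
    (f := fun (j : ℕ) (k : Fin n) => x (j + k)) (fun j => ⟨j, fun k => rfl⟩)
    (finite_setOf_blocks hx n)
  obtain ⟨m, hm⟩ := hper i j hij
  have hall : ∀ m, BlockEq x (i + m) (j + m) n := by
    intro m
    induction m with
    | zero => exact fun k hk => congrFun he ⟨k, hk⟩
    | succ m ih =>
      intro k hk
      have := hext _ _ ih (k + 1) (by omega)
      rwa [show i + m + (k + 1) = i + (m + 1) + k by ring,
        show j + m + (k + 1) = j + (m + 1) + k by ring] at this
  exact hm fun k _ => hext _ _ (hall k) 0 (by omega)

lemma complexity_add_le {b : ℕ} {x : ℕ → ℕ} (hx : ∀ k, x k < b)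
    (hper : ∀ i j, i < j → ∃ m, ¬ BlockEq x i j m) (n l : ℕ) :
    complexity x n + l ≤ complexity x (n + l) := by
  induction l with
  | zero => rfl
  | succ l ih =>
    have := complexity_lt_complexity_succ hx hper (n + l)
    rw [← add_assoc n l 1]
    omega

lemma exists_blockEq_of_le_complexity {b : ℕ} {x : ℕ → ℕ} (hx : ∀ k, x k < b) (n : ℕ) :
    ∃ i j, i < j ∧ j ≤ complexity x n ∧ BlockEq x i j n := by
  have hfin := finite_setOf_blocks hx n
  obtain ⟨i, hi, j, hj, hij, he⟩ := Finset.exists_ne_map_eq_of_card_lt_of_maps_to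
    (s := Finset.range (complexity x n + 1)) (t := hfin.toFinset)
    (by rw [Finset.card_range, ← Set.ncard_eq_toFinset_card _ hfin]; exact Nat.lt_succ_self _)
    (f := fun (j : ℕ) (k : Fin n) => x (j + k))
    (fun j _ => by simpa using ⟨j, fun k => rfl⟩)
  simp only [Finset.mem_range] at hi hj
  rcases lt_or_gt_of_ne hij with h | h
  · exact ⟨i, j, h, by omega, fun k hk => congrFun he ⟨k, hk⟩⟩
  · exact ⟨j, i, h, by omega, fun k hk => (congrFun he ⟨k, hk⟩).symm⟩

section Digits

variable {b : ℕ} {ξ : ℝ}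

lemma digit_lt (hb : 2 ≤ b) (k : ℕ) : digit b ξ k < b := by
  unfold digit
  have := Int.emod_lt_of_pos ⌊ξ * (b : ℝ) ^ (k + 1)⌋ (by omega : (0 : ℤ) < b)
  omega

lemma floor_mul_pow_succ (hb : 2 ≤ b) (k : ℕ) :
    ⌊ξ * (b : ℝ) ^ (k + 1)⌋ = b * ⌊ξ * (b : ℝ) ^ k⌋ + digit b ξ k := by
  have hb0 : (0 : ℝ) < b := by positivity
  have hdiv : ⌊ξ * (b : ℝ) ^ k⌋ = ⌊ξ * (b : ℝ) ^ (k + 1)⌋ / (b : ℤ) := by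
    rw [← Int.floor_div_natCast, pow_succ, ← mul_assoc, mul_div_assoc, div_self hb0.ne', mul_one]
  unfold digit
  rw [Int.toNat_of_nonneg (Int.emod_nonneg _ (by omega)), hdiv, Int.mul_ediv_add_emod]

lemma BlockEq.floor_sub {i j m : ℕ} (hb : 2 ≤ b) (h : BlockEq (digit b ξ) i j m) :
    ⌊ξ * (b : ℝ) ^ (j + m)⌋ - ⌊ξ * (b : ℝ) ^ (i + m)⌋ =
      b ^ m * (⌊ξ * (b : ℝ) ^ j⌋ - ⌊ξ * (b : ℝ) ^ i⌋) := by
  induction m with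
  | zero => simp
  | succ m ih =>
    rw [← add_assoc, ← add_assoc, floor_mul_pow_succ hb, floor_mul_pow_succ hb,
      h m (Nat.lt_succ_self m), pow_succ]
    linear_combination (b : ℤ) * ih (h.mono (Nat.le_succ m))

/-- A repeated block of digits gives a rational approximation. -/
lemma BlockEq.abs_sub_lt {i j m : ℕ} (hb : 2 ≤ b) (h : BlockEq (digit b ξ) i j m) :
    |((b : ℝ) ^ j - (b : ℝ) ^ i) * ξ - ((⌊ξ * (b : ℝ) ^ j⌋ - ⌊ξ * (b : ℝ) ^ i⌋ : ℤ) : ℝ)|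
      * (b : ℝ) ^ m < 1 := by
  have hb0 : (0 : ℝ) < (b : ℝ) ^ m := by positivity
  have hfl := congrArg (Int.cast : ℤ → ℝ) (h.floor_sub hb)
  push_cast at hfl
  rw [← abs_of_pos hb0, ← abs_mul]
  have e : (((b : ℝ) ^ j - (b : ℝ) ^ i) * ξ -
      ((⌊ξ * (b : ℝ) ^ j⌋ - ⌊ξ * (b : ℝ) ^ i⌋ : ℤ) : ℝ)) * (b : ℝ) ^ m =
      Int.fract (ξ * (b : ℝ) ^ (j + m)) - Int.fract (ξ * (b : ℝ) ^ (i + m)) := by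
    unfold Int.fract
    push_cast
    rw [pow_add, pow_add] at *
    linear_combination hfl
  rw [e, abs_lt]
  have h1 := Int.fract_nonneg (ξ * (b : ℝ) ^ (j + m))
  have h2 := Int.fract_lt_one (ξ * (b : ℝ) ^ (j + m))
  have h3 := Int.fract_nonneg (ξ * (b : ℝ) ^ (i + m))
  have h4 := Int.fract_lt_one (ξ * (b : ℝ) ^ (i + m))
  constructor <;> linarith

lemma finite_approximations {μ : ℝ} (hμ : irrationalityExponent ξ < (μ : EReal)) :
    {pq : ℤ × ℕ | 1 ≤ pq.2 ∧ |ξ - pq.1 / pq.2| < (pq.2 : ℝ) ^ (-μ)}.Finite := by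
  by_contra h
  refine (le_sSup ?_ : (μ : EReal) ≤ irrationalityExponent ξ).not_gt hμ
  exact ⟨μ, rfl, h⟩

/-- Long repeated blocks of digits cannot occur early. -/
lemma exists_forall_blockEq_le (hb : 2 ≤ b) (hξ : Irrational ξ) {ε : ℝ} (hε : 0 ≤ ε)
    (hμ : irrationalityExponent ξ < ((2 + ε : ℝ) : EReal)) :
    ∃ M, ∀ i j m, i < j → M ≤ m → BlockEq (digit b ξ) i j m → (m : ℝ) ≤ (1 + ε) * j := by
  have hfin := finite_approximations hμ
  set S := {pq : ℤ × ℕ | 1 ≤ pq.2 ∧ |ξ - pq.1 / pq.2| < (pq.2 : ℝ) ^ (-(2 + ε))}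
  have hb1 : (1 : ℝ) < b := by exact_mod_cast hb
  have hb0 : (0 : ℝ) < b := by positivity
  have hM : ∀ᶠ m : ℕ in atTop, ∀ pq ∈ S, 1 ≤ |(pq.2 : ℝ) * ξ - pq.1| * (b : ℝ) ^ m := by
    rw [Filter.eventually_all_finite hfin]
    rintro ⟨p, q⟩ ⟨hq, -⟩
    have hne : (q : ℝ) * ξ - p ≠ 0 := by
      intro h
      have hq' : q ≠ 0 := by simp only at hq; omega
      exact (hξ.natCast_mul hq').ne_int p (by linarith)
    exact ((tendsto_pow_atTop_atTop_of_one_lt hb1).const_mul_atTop (abs_pos.mpr hne)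
      ).eventually_ge_atTop 1
  obtain ⟨M, hM⟩ := eventually_atTop.mp hM
  refine ⟨M, fun i j m hij hMm h => ?_⟩
  have happ := h.abs_sub_lt hb
  set p : ℤ := ⌊ξ * (b : ℝ) ^ j⌋ - ⌊ξ * (b : ℝ) ^ i⌋
  have hlt : b ^ i < b ^ j := Nat.pow_lt_pow_right (by omega) hij
  obtain ⟨q, hq⟩ : ∃ q : ℕ, q = b ^ j - b ^ i := ⟨_, rfl⟩
  have hqR : (b : ℝ) ^ j - (b : ℝ) ^ i = q := by
    rw [hq, Nat.cast_sub hlt.le]; push_cast; rfl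
  rw [hqR] at happ
  have hq1 : 1 ≤ q := by omega
  have hq0 : (0 : ℝ) < q := by exact_mod_cast hq1
  have hqle : (q : ℝ) ≤ (b : ℝ) ^ j := by rw [← hqR]; linarith [pow_pos hb0 i]
  have hnot : (p, q) ∉ S := fun hmem => absurd (hM m hMm _ hmem) (not_le.mpr happ)
  have hge : (q : ℝ) ^ (-(2 + ε)) ≤ |ξ - p / q| := by
    by_contra! hcon
    exact hnot ⟨hq1, hcon⟩
  have habs : |(q : ℝ) * ξ - p| = q * |ξ - p / q| := by
    rw [← abs_of_pos hq0, ← abs_mul, abs_of_pos hq0, mul_sub, mul_div_cancel₀ _ hq0.ne']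
  have h1 : (q : ℝ) ^ (-(1 + ε)) ≤ |(q : ℝ) * ξ - p| := by
    rw [habs]
    calc (q : ℝ) ^ (-(1 + ε)) = q * (q : ℝ) ^ (-(2 + ε)) := by
          rw [show -(1 + ε) = 1 + -(2 + ε) by ring, Real.rpow_add hq0, Real.rpow_one]
      _ ≤ _ := by gcongr
  have h2 : (b : ℝ) ^ m < (q : ℝ) ^ (1 + ε) := by
    rw [Real.rpow_neg hq0.le] at h1
    have hpos : (0 : ℝ) < (q : ℝ) ^ (1 + ε) := Real.rpow_pos_of_pos hq0 _
    have := (mul_le_mul_of_nonneg_right h1 (pow_pos hb0 m).le).trans_lt happ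
    rwa [inv_mul_lt_iff₀ hpos, mul_one] at this
  have h3 : (b : ℝ) ^ (m : ℝ) < (b : ℝ) ^ ((1 + ε) * j) := by
    calc (b : ℝ) ^ (m : ℝ) = (b : ℝ) ^ m := Real.rpow_natCast _ _
      _ < (q : ℝ) ^ (1 + ε) := h2
      _ ≤ ((b : ℝ) ^ j) ^ (1 + ε) := by gcongr
      _ = (b : ℝ) ^ ((1 + ε) * j) := by
          rw [← Real.rpow_natCast, ← Real.rpow_mul hb0.le, mul_comm]
  exact ((Real.rpow_lt_rpow_left_iff hb1).mp h3).le

end Digits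

theorem stmt12 {b : ℕ} (hb : 2 ≤ b) (ξ : ℝ) (hξ : Irrational ξ)
    (hμ : irrationalityExponent ξ = (2 : EReal)) :
    ((9 / 8 : ℝ) : EReal) ≤
      liminf (fun n : ℕ => (((complexity (digit b ξ) n : ℝ) / n : ℝ) : EReal)) atTop := by
  by_contra! hlim
  obtain ⟨c₀, hc₀, hc₀'⟩ := EReal.lt_iff_exists_real_btwn.mp hlim
  have hfreq := frequently_lt_of_liminf_lt (h := hc₀)
  obtain ⟨c, hc₀c, hc1, hc⟩ : ∃ c : ℝ, c₀ ≤ c ∧ 1 ≤ c ∧ c < 9 / 8 :=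
    ⟨max c₀ 1, le_max_left _ _, le_max_right _ _,
      max_lt (by exact_mod_cast hc₀') (by norm_num)⟩
  set ε : ℝ := (9 / 8 - c) / 4 with hε
  have hε0 : 0 < ε := by rw [hε]; linarith
  have hμε : irrationalityExponent ξ < ((2 + ε : ℝ) : EReal) := by
    rw [hμ, show (2 : EReal) = ((2 : ℝ) : EReal) from rfl, EReal.coe_lt_coe_iff]
    linarith
  obtain ⟨M, hM⟩ := exists_forall_blockEq_le hb hξ hε0.le hμε
  have hdig := digit_lt (b := b) (ξ := ξ) hb
  have hper : ∀ i j, i < j → ∃ m, ¬ BlockEq (digit b ξ) i j m := by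
    intro i j hij
    obtain ⟨m, hm⟩ := exists_nat_gt ((1 + ε) * j)
    refine ⟨max m M, fun h => ?_⟩
    have := hM i j _ hij (le_max_right _ _) h
    have h2 : (m : ℝ) ≤ (max m M : ℕ) := by exact_mod_cast le_max_left m M
    linarith
  have hlarge : ∀ᶠ N : ℕ in atTop, (7 + M : ℝ) < 16 * ε * N :=
    (tendsto_natCast_atTop_atTop.const_mul_atTop (by positivity)).eventually_gt_atTop _
  obtain ⟨N, hN, hNl, hN0⟩ := (hfreq.and_eventually (hlarge.and (eventually_gt_atTop 0))).exists
  have hN0' : (0 : ℝ) < N := by exact_mod_cast hN0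
  have hpN : (complexity (digit b ξ) N : ℝ) < c * N := by
    rw [EReal.coe_lt_coe_iff, div_lt_iff₀ hN0'] at hN
    exact hN.trans_le (by gcongr)
  obtain ⟨d, hd⟩ : ∃ d, d = complexity (digit b ξ) N - N := ⟨_, rfl⟩
  have hdle : (d : ℝ) ≤ (c - 1) * N := by
    rcases le_total (complexity (digit b ξ) N) N with h | h
    · rw [hd, Nat.sub_eq_zero_of_le h, Nat.cast_zero]
      exact mul_nonneg (by linarith) hN0'.le
    · rw [hd, Nat.cast_sub h]
      linarith
  have hE : (⌊2 * ε * N⌋₊ : ℝ) ≤ 2 * ε * N := Nat.floor_le (by positivity)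
  refine not_forall_exists_blockEq (x := digit b ξ) (N := N) (d := d) (E := ⌊2 * ε * N⌋₊) (M := M)
    ?_ ?_ ?_
  · have : (8 * d + 8 * ⌊2 * ε * N⌋₊ + 7 + M : ℝ) < N := by
      have : (c - 1) * N = N / 8 - 4 * ε * N := by rw [hε]; ring
      linarith
    exact_mod_cast this
  · intro i j m hij hj hm h
    have h1 := hM i j m hij hm h
    have hj' : (j : ℝ) ≤ 2 * N := by exact_mod_cast hj
    have h2 : (m : ℝ) - j ≤ 2 * ε * N := by nlinarith
    have h3 : m - j ≤ ⌊2 * ε * N⌋₊ := by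
      rcases le_total m j with hmj | hmj
      · omega
      · exact Nat.le_floor (by rw [Nat.cast_sub hmj]; exact h2)
    omega
  · intro n hn
    obtain ⟨i, j, hij, hj, h⟩ := exists_blockEq_of_le_complexity hdig n
    have := complexity_add_le hdig hper n (N - n)
    rw [show n + (N - n) = N by omega] at this
    exact ⟨i, j, hij, by omega, h⟩
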